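/- In the overlap array setup, suppose μ satisfies the Ghirlanda–Guerra identities for system 1, μ is a.s. positive semidefinite, and μ( |R_{l,l'}| = |R_{1,1}| for all l, l' ≥ 1 ) = 1. Let μ₁ be the law of |R¹_{1,2}| under μ and let c₁ = inf supp μ₁. Then μ( |R_{1,1}| > √c₁ ) = 0. -/

import Mathlib

open MeasureTheory

namespace OverlapArray

/-- The space `([-1,1]^{ℕ×ℕ})³` of triples of overlap arrays
`((R¹_{l,l'}), (R²_{l,l'}), (R_{l,l'}))` (realized inside `(ℝ^{ℕ×ℕ})³`, the constraint that
entries lie in `[-1,1]` being imposed almost surely). -/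
abbrev OA : Type := (ℕ → ℕ → ℝ) × (ℕ → ℕ → ℝ) × (ℕ → ℕ → ℝ)

/-- The overlap array `(R¹_{l,l'})` of the first system. -/
def R1 (ω : OA) : ℕ → ℕ → ℝ := ω.1

/-- The overlap array `(R²_{l,l'})` of the second system. -/
def R2 (ω : OA) : ℕ → ℕ → ℝ := ω.2.1

/-- The array `(R_{l,l'})` of cross overlaps. -/
def R (ω : OA) : ℕ → ℕ → ℝ := ω.2.2

/-- Relabelling the replicas of the first system by `π` and of the second system by `π'`. -/
def permMap (π π' : Equiv.Perm ℕ) (ω : OA) : OA :=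
  (fun l l' => R1 ω (π l) (π l'), fun l l' => R2 ω (π' l) (π' l'),
   fun l l' => R ω (π l) (π' l'))

/-- The overlap array setup: `μ` is a probability measure on `OA` with entries a.s. in
`[-1,1]`, `R¹, R²` a.s. symmetric with unit diagonal, and `μ` invariant under finitely
supported permutations of the replicas of each system. -/
structure Setup (μ : Measure OA) : Prop where
  prob : IsProbabilityMeasure μ
  bounded : ∀ᵐ ω ∂μ, ∀ l l', |R1 ω l l'| ≤ 1 ∧ |R2 ω l l'| ≤ 1 ∧ |R ω l l'| ≤ 1
  symm : ∀ᵐ ω ∂μ, ∀ l l', R1 ω l l' = R1 ω l' l ∧ R2 ω l l' = R2 ω l' l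
  diag : ∀ᵐ ω ∂μ, ∀ l, R1 ω l l = 1 ∧ R2 ω l l = 1
  exch : ∀ π π' : Equiv.Perm ℕ, {x | π x ≠ x}.Finite → {x | π' x ≠ x}.Finite →
    μ.map (permMap π π') = μ

/-- Evaluation of a function `f` of the overlaps on the first `n` replicas. -/
def fRep (n : ℕ)
    (f : ((Fin n → Fin n → ℝ) × (Fin n → Fin n → ℝ) × (Fin n → Fin n → ℝ)) → ℝ)
    (ω : OA) : ℝ :=
  f (fun l l' => R1 ω l.val l'.val, fun l l' => R2 ω l.val l'.val,
     fun l l' => R ω l.val l'.val)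

/-- The Ghirlanda–Guerra identities for system 1: for every `n ≥ 1`, every bounded
measurable function `f` of the overlaps on `n` replicas and every bounded Borel even
`ψ : [-1,1] → ℝ`,
`E[f·ψ(R¹_{1,n+1})] = (1/n) E[f]·E[ψ(R¹_{1,2})] + (1/n) ∑_{l=2}^n E[f·ψ(R¹_{1,l})]`
(replicas are indexed from `0` here, so `R¹_{1,l}` is `R1 ω 0 (l-1)`). -/
def GG1 (μ : Measure OA) : Prop :=
  ∀ n : ℕ, 1 ≤ n →
  ∀ f : ((Fin n → Fin n → ℝ) × (Fin n → Fin n → ℝ) × (Fin n → Fin n → ℝ)) → ℝ,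
    Measurable f → (∃ C, ∀ v, |f v| ≤ C) →
  ∀ ψ : ℝ → ℝ, Measurable ψ → (∃ C, ∀ x, |ψ x| ≤ C) → (∀ x, ψ (-x) = ψ x) →
    ∫ ω, fRep n f ω * ψ (R1 ω 0 n) ∂μ
      = (1 / n) * (∫ ω, fRep n f ω ∂μ) * (∫ ω, ψ (R1 ω 0 1) ∂μ)
        + (1 / n) * ∑ l ∈ Finset.Ico 1 n, ∫ ω, fRep n f ω * ψ (R1 ω 0 l) ∂μ

/-- The Ghirlanda–Guerra identities for system 2. -/
def GG2 (μ : Measure OA) : Prop :=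
  ∀ n : ℕ, 1 ≤ n →
  ∀ f : ((Fin n → Fin n → ℝ) × (Fin n → Fin n → ℝ) × (Fin n → Fin n → ℝ)) → ℝ,
    Measurable f → (∃ C, ∀ v, |f v| ≤ C) →
  ∀ ψ : ℝ → ℝ, Measurable ψ → (∃ C, ∀ x, |ψ x| ≤ C) → (∀ x, ψ (-x) = ψ x) →
    ∫ ω, fRep n f ω * ψ (R2 ω 0 n) ∂μ
      = (1 / n) * (∫ ω, fRep n f ω ∂μ) * (∫ ω, ψ (R2 ω 0 1) ∂μ)
        + (1 / n) * ∑ l ∈ Finset.Ico 1 n, ∫ ω, fRep n f ω * ψ (R2 ω 0 l) ∂μ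

/-- The event `{R_{1,1} ∈ A}`. -/
def EA (A : Set ℝ) : Set OA := {ω | R ω 0 0 ∈ A}

/-- The event `{|R¹_{l,l'}| ∈ A₁ for all l ≠ l' ≤ n}` (with `0`-based replica indices). -/
def E1 (n : ℕ) (A1 : Set ℝ) : Set OA :=
  {ω | ∀ l l', l < n → l' < n → l ≠ l' → |R1 ω l l'| ∈ A1}

/-- The event `{|R²_{l,l'}| ∈ A₂ for all l ≠ l' ≤ n}` (with `0`-based replica indices). -/
def E2 (n : ℕ) (A2 : Set ℝ) : Set OA :=
  {ω | ∀ l l', l < n → l' < n → l ≠ l' → |R2 ω l l'| ∈ A2}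

/-- The event `B_n`. -/
def Bev (n : ℕ) (A A1 A2 : Set ℝ) : Set OA := EA A ∩ E1 n A1 ∩ E2 n A2

/-- The event `C_n`. -/
def Cev (n : ℕ) (A A1 A2 : Set ℝ) : Set OA := EA A ∩ E1 (n + 1) A1 ∩ E2 n A2

end OverlapArray

namespace OverlapArray

/-- The joint `2n×2n` overlap matrix of `n` replicas of each system: blocks `R¹`, `R`, `Rᵀ`,
`R²`. -/
def ovMatrix (ω : OA) (n : ℕ) : Matrix (Fin n ⊕ Fin n) (Fin n ⊕ Fin n) ℝ :=
  fun i j =>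
    match i, j with
    | Sum.inl l, Sum.inl l' => R1 ω l.val l'.val
    | Sum.inl l, Sum.inr l' => R ω l.val l'.val
    | Sum.inr l, Sum.inl l' => R ω l'.val l.val
    | Sum.inr l, Sum.inr l' => R2 ω l.val l'.val

/-- `μ` is a.s. positive semidefinite: almost surely all the joint overlap matrices are
positive semidefinite. -/
def PSDas (μ : MeasureTheory.Measure OA) : Prop :=
  ∀ᵐ ω ∂μ, ∀ n : ℕ, 1 ≤ n → (ovMatrix ω n).PosSemidef

/-- The support of the law `μ₁` of `|R¹_{1,2}|` under `μ`: the set of points all of whose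
open neighbourhoods have positive measure (i.e. the smallest closed set of full measure). -/
def supp1 (μ : MeasureTheory.Measure OA) : Set ℝ :=
  {x | ∀ U : Set ℝ, IsOpen U → x ∈ U → 0 < μ {ω | |R1 ω 0 1| ∈ U}}

/-- The support of the law `μ₂` of `|R²_{1,2}|` under `μ`. -/
def supp2 (μ : MeasureTheory.Measure OA) : Set ℝ :=
  {x | ∀ U : Set ℝ, IsOpen U → x ∈ U → 0 < μ {ω | |R2 ω 0 1| ∈ U}}

end OverlapArray

open OverlapArray

namespace OverlapArray

theorem measurable_R1 (l l' : ℕ) : Measurable (fun ω : OA => R1 ω l l') := by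
  unfold R1; fun_prop

theorem measurable_R (l l' : ℕ) : Measurable (fun ω : OA => R ω l l') := by
  unfold R; fun_prop

theorem measurable_permMap (π π' : Equiv.Perm ℕ) : Measurable (permMap π π') := by
  unfold permMap R1 R2 R
  fun_prop

/-- The event that the first cross overlap exceeds `a` and the first `n` replicas of system 1
have pairwise overlaps below `b`. -/
def Ev (a b : ℝ) (n : ℕ) : Set OA :=
  {ω | a < |R ω 0 0|} ∩ {ω | ∀ l l', l < n → l' < n → l ≠ l' → |R1 ω l l'| < b}

theorem measurableSet_Ev (a b : ℝ) (n : ℕ) : MeasurableSet (Ev a b n) := by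
  unfold Ev
  refine MeasurableSet.inter (measurableSet_lt measurable_const (measurable_R 0 0).abs) ?_
  simp only [Set.setOf_forall]
  refine MeasurableSet.iInter fun l => MeasurableSet.iInter fun l' => MeasurableSet.iInter fun _ =>
    MeasurableSet.iInter fun _ => MeasurableSet.iInter fun _ => ?_
  exact measurableSet_lt (measurable_R1 l l').abs measurable_const

/-- Deterministic part: positive semidefiniteness bounds the overlaps. -/
theorem psd_bound (ω : OA) (m : ℕ) (a b : ℝ) (ha : 0 ≤ a)
    (hpsd : (ovMatrix ω (m + 1)).PosSemidef)
    (hd1 : ∀ l, R1 ω l l = 1) (hd2 : R2 ω 0 0 = 1)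
    (hc : ∀ l l', |R ω l l'| = |R ω 0 0|)
    (hE : ω ∈ Ev a b (m + 1)) :
    ((m : ℝ) + 1) * (a ^ 2 - b) ≤ 1 - b := by
  obtain ⟨h1, h2⟩ := hE
  simp only [Set.mem_setOf_eq] at h1 h2
  set r := |R ω 0 0| with hr
  let s : Fin (m + 1) → ℝ := fun i => if 0 ≤ R ω i 0 then 1 else -1
  have hs : ∀ i, s i * R ω i 0 = r := by
    intro i
    rw [← hc i 0]
    by_cases h : 0 ≤ R ω i 0
    · simp [s, h, abs_of_nonneg h]
    · simp [s, h, abs_of_neg (not_le.mp h)]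
  have hs1 : ∀ i, |s i| = 1 := by
    intro i
    by_cases h : 0 ≤ R ω i 0 <;> simp [s, h]
  let t : ℝ := ((m : ℝ) + 1) * r
  let x : Fin (m + 1) ⊕ Fin (m + 1) → ℝ := Sum.elim s (fun j => if j = 0 then -t else 0)
  have hq := hpsd.dotProduct_mulVec_nonneg x
  have hexp : star x ⬝ᵥ (ovMatrix ω (m + 1)).mulVec x
      = (∑ i : Fin (m + 1), ∑ j : Fin (m + 1), s i * s j * R1 ω i j)
        - 2 * t * (∑ i : Fin (m + 1), s i * R ω i 0) + t ^ 2 := by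
    simp only [dotProduct, Matrix.mulVec, Fintype.sum_sum_type, x, ovMatrix, Pi.star_apply,
      Sum.elim_inl, Sum.elim_inr, star_trivial]
    simp only [mul_ite, ite_mul, mul_zero, zero_mul, Finset.sum_ite_eq', Finset.mem_univ,
      if_true, Fin.val_zero, hd2]
    simp only [mul_add, Finset.sum_add_distrib, Finset.mul_sum]
    have e1 : ∀ i j : Fin (m+1), s i * (R1 ω i j * s j) = s i * s j * R1 ω i j :=
      fun i j => by ring
    have e2 : ∀ i : Fin (m+1), s i * (R ω i 0 * -t) = -(t * (s i * R ω i 0)) :=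
      fun i => by ring
    have e3 : ∀ i : Fin (m+1), -t * (R ω i 0 * s i) = -(t * (s i * R ω i 0)) :=
      fun i => by ring
    have e4 : ∀ i : Fin (m+1), 2 * t * (s i * R ω i 0) = 2 * (t * (s i * R ω i 0)) :=
      fun i => by ring
    simp only [e1, e2, e3, e4, Finset.sum_neg_distrib, ← Finset.mul_sum]
    ring
  rw [hexp] at hq
  have hb : (∑ i : Fin (m + 1), ∑ j : Fin (m + 1), s i * s j * R1 ω i j)
      ≤ ∑ i : Fin (m + 1), ∑ j : Fin (m + 1), (b + if i = j then 1 - b else 0) := by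
    refine Finset.sum_le_sum fun i _ => Finset.sum_le_sum fun j _ => ?_
    refine (le_abs_self _).trans ?_
    rw [abs_mul, abs_mul, hs1, hs1]
    by_cases hij : i = j
    · subst hij; simp [hd1]
    · have := h2 i j i.2 j.2 (fun h => hij (Fin.ext h))
      simp [hij]; linarith
  have hb2 : ∑ i : Fin (m + 1), ∑ j : Fin (m + 1), (b + if i = j then 1 - b else 0)
      = ((m : ℝ) + 1) * (((m : ℝ) + 1) * b + (1 - b)) := by
    simp [Finset.sum_add_distrib]
    ring
  have hsr : ∑ i : Fin (m + 1), s i * R ω i 0 = ((m : ℝ) + 1) * r := by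
    simp [hs]
  rw [hb2] at hb
  rw [hsr] at hq
  have hm : (0 : ℝ) < (m : ℝ) + 1 := by positivity
  have hra : a ^ 2 ≤ r ^ 2 := pow_le_pow_left₀ ha h1.le 2
  have h3 : 0 ≤ ((m : ℝ) + 1) * (((m : ℝ) + 1) * b + (1 - b) - ((m : ℝ) + 1) * r ^ 2) := by
    simp only [t] at hq; nlinarith
  have h4 := nonneg_of_mul_nonneg_right h3 hm
  nlinarith

theorem supp1_nonempty (μ : Measure OA) [IsProbabilityMeasure μ] : (supp1 μ).Nonempty := by
  have hm : Measurable (fun ω : OA => |R1 ω 0 1|) := (measurable_R1 0 1).abs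
  have : IsProbabilityMeasure (μ.map (fun ω : OA => |R1 ω 0 1|)) :=
    Measure.isProbabilityMeasure_map hm.aemeasurable
  obtain ⟨x, hx⟩ := Measure.nonempty_support
    (IsProbabilityMeasure.ne_zero (μ.map (fun ω : OA => |R1 ω 0 1|)))
  refine ⟨x, fun U hU hxU => ?_⟩
  rw [Measure.mem_support_iff_forall] at hx
  have := hx U (hU.mem_nhds hxU)
  rwa [Measure.map_apply hm hU.measurableSet] at this

theorem swap_invariance (μ : Measure OA) (hsetup : Setup μ)
    (hc : ∀ᵐ ω ∂μ, ∀ l l', |R ω l l'| = |R ω 0 0|) (a b : ℝ) (n l : ℕ) (hl : l < n) :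
    μ (Ev a b n ∩ {ω | b ≤ |R1 ω l n|}) = μ (Ev a b n ∩ {ω | b ≤ |R1 ω 0 n|}) := by
  have hex := hsetup.exch (Equiv.swap 0 l) 1
    (Set.Finite.subset (Set.toFinite {0, l}) (by
      intro x hx
      by_contra h
      simp only [Set.mem_insert_iff, Set.mem_singleton_iff, not_or] at h
      exact hx (Equiv.swap_apply_of_ne_of_ne h.1 h.2))) (by simp)
  have hms : MeasurableSet (Ev a b n ∩ {ω | b ≤ |R1 ω 0 n|}) :=
    (measurableSet_Ev a b n).inter (measurableSet_le measurable_const (measurable_R1 0 n).abs)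
  conv_rhs => rw [← hex, Measure.map_apply (measurable_permMap _ _) hms]
  refine measure_congr ?_
  filter_upwards [hc] with ω hω
  have hlt : ∀ i, i < n ↔ Equiv.swap 0 l i < n := by
    intro i
    rcases eq_or_ne i 0 with rfl | h0
    · simp; omega
    · rcases eq_or_ne i l with rfl | h1
      · simp; omega
      · rw [Equiv.swap_apply_of_ne_of_ne h0 h1]
  have hn : Equiv.swap 0 l n = n := Equiv.swap_apply_of_ne_of_ne (by omega) (by omega)
  apply propext
  show (_ ∧ _) ↔ (_ ∧ _)
  refine and_congr (and_congr ?_ ?_) ?_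
  · show a < |R ω 0 0| ↔ a < |R ω (Equiv.swap 0 l 0) 0|
    rw [hω (Equiv.swap 0 l 0) 0]
  · show (∀ i j, _) ↔ ∀ i j, i < n → j < n → i ≠ j →
      |R1 ω (Equiv.swap 0 l i) (Equiv.swap 0 l j)| < b
    constructor
    · intro h i j hi hj hij
      exact h _ _ ((hlt i).1 hi) ((hlt j).1 hj) (fun e => hij ((Equiv.swap 0 l).injective e))
    · intro h i j hi hj hij
      have := h (Equiv.swap 0 l i) (Equiv.swap 0 l j) ((hlt i).1 hi) ((hlt j).1 hj)
        (fun e => hij ((Equiv.swap 0 l).injective e))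
      simpa using this
  · show b ≤ |R1 ω l n| ↔ b ≤ |R1 ω (Equiv.swap 0 l 0) (Equiv.swap 0 l n)|
    rw [hn, Equiv.swap_apply_left]

theorem gg_step (μ : Measure OA) [IsProbabilityMeasure μ] (hGG : GG1 μ) (a b : ℝ) (m : ℕ) :
    ((m : ℝ) + 1) * μ.real (Ev a b (m + 1) ∩ {ω | b ≤ |R1 ω 0 (m + 1)|})
      = μ.real (Ev a b (m + 1)) * μ.real {ω | b ≤ |R1 ω 0 1|} := by
  classical
  let S : Set ((Fin (m+1) → Fin (m+1) → ℝ) × (Fin (m+1) → Fin (m+1) → ℝ) ×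
      (Fin (m+1) → Fin (m+1) → ℝ)) :=
    {v | a < |v.2.2 0 0|} ∩ ⋂ l, ⋂ l', ⋂ _ : l ≠ l', {v | |v.1 l l'| < b}
  have hS : MeasurableSet S := by
    refine MeasurableSet.inter (measurableSet_lt measurable_const (by fun_prop)) ?_
    refine MeasurableSet.iInter fun l => MeasurableSet.iInter fun l' =>
      MeasurableSet.iInter fun _ => measurableSet_lt (by fun_prop) measurable_const
  let T : Set ℝ := {x | b ≤ |x|}
  have hT : MeasurableSet T := measurableSet_le measurable_const measurable_id.abs
  have key := hGG (m + 1) (by omega) (S.indicator 1) (measurable_one.indicator hS)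
    ⟨1, fun v => by by_cases h : v ∈ S <;> simp [h]⟩ (T.indicator 1)
    (measurable_one.indicator hT)
    ⟨1, fun v => by by_cases h : v ∈ T <;> simp [h]⟩
    (fun x => by simp [Set.indicator, T])
  have hf : ∀ ω, fRep (m + 1) (S.indicator 1) ω = (Ev a b (m + 1)).indicator 1 ω := by
    intro ω
    unfold fRep
    simp only [Set.indicator]
    congr 1
    simp only [S, Ev, Set.mem_inter_iff, Set.mem_setOf_eq, Set.mem_iInter, Fin.val_zero]
    refine propext (and_congr Iff.rfl ?_)
    constructor
    · intro h i j hi hj hij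
      exact h ⟨i, hi⟩ ⟨j, hj⟩ (by simpa using hij)
    · intro h i j hij
      exact h i j i.2 j.2 (fun e => hij (Fin.ext e))
  have hg : ∀ l, (fun ω => T.indicator (1 : ℝ → ℝ) (R1 ω 0 l))
      = ({ω | b ≤ |R1 ω 0 l|} : Set OA).indicator 1 := by
    intro l; rfl
  have hmT : ∀ l, MeasurableSet ({ω | b ≤ |R1 ω 0 l|} : Set OA) := fun l =>
    measurableSet_le measurable_const (measurable_R1 0 l).abs
  have hfg : ∀ l, ∫ ω, fRep (m + 1) (S.indicator 1) ω * T.indicator 1 (R1 ω 0 l) ∂μ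
      = μ.real (Ev a b (m + 1) ∩ {ω | b ≤ |R1 ω 0 l|}) := by
    intro l
    rw [← integral_indicator_one ((measurableSet_Ev a b (m+1)).inter (hmT l))]
    refine integral_congr_ae (Filter.Eventually.of_forall fun ω => ?_)
    simp only [hf]
    rw [congrFun (hg l) ω]
    rw [Set.inter_indicator_one]
    rfl
  simp only [hfg] at key
  have h0 : ∑ l ∈ Finset.Ico 1 (m + 1), μ.real (Ev a b (m + 1) ∩ {ω | b ≤ |R1 ω 0 l|}) = 0 := by
    refine Finset.sum_eq_zero fun l hl => ?_
    rw [Finset.mem_Ico] at hl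
    have : Ev a b (m + 1) ∩ {ω | b ≤ |R1 ω 0 l|} = ∅ := by
      ext ω
      simp only [Set.mem_inter_iff, Set.mem_setOf_eq, Set.mem_empty_iff_false, iff_false, not_and,
        not_le]
      intro h
      exact h.2 0 l (by omega) hl.2 (by omega)
    simp [this]
  rw [h0, hg 1, integral_indicator_one (hmT 1)] at key
  simp only [hf] at key
  rw [integral_indicator_one (measurableSet_Ev a b (m+1))] at key
  rw [key]
  push_cast
  field_simp
  ring

theorem Ev_step (μ : Measure OA) (hsetup : Setup μ) (hGG : GG1 μ)
    (hc : ∀ᵐ ω ∂μ, ∀ l l', |R ω l l'| = |R ω 0 0|) (a b : ℝ)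
    (hb : 0 < μ {ω | |R1 ω 0 1| < b}) (m : ℕ) (h : 0 < μ (Ev a b (m + 1))) :
    0 < μ (Ev a b (m + 2)) := by
  have := hsetup.prob
  have hgg := gg_step μ hGG a b m
  have hsub : μ.real (Ev a b (m + 1)) ≤ μ.real (Ev a b (m + 2))
      + ∑ l ∈ Finset.range (m + 1), μ.real (Ev a b (m + 1) ∩ {ω | b ≤ |R1 ω l (m + 1)|}) := by
    have h1 : μ.real (Ev a b (m + 1)) ≤ μ.real (Ev a b (m + 2) ∪
        ⋃ l ∈ Finset.range (m + 1), (Ev a b (m + 1) ∩ {ω | b ≤ |R1 ω l (m + 1)|})) := by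
      refine ENNReal.toReal_mono (measure_ne_top _ _) (measure_mono_ae ?_)
      filter_upwards [hsetup.symm] with ω hs hω
      by_cases hx : ∃ l, l < m + 1 ∧ b ≤ |R1 ω l (m + 1)|
      · obtain ⟨l, hl, hx⟩ := hx
        refine Or.inr ?_
        simp only [Set.mem_iUnion]
        exact ⟨l, Finset.mem_range.2 hl, hω, hx⟩
      · push Not at hx
        refine Or.inl ⟨hω.1, ?_⟩
        intro i j hi hj hij
        rcases Nat.lt_succ_iff_lt_or_eq.1 hi with hi' | rfl
        · rcases Nat.lt_succ_iff_lt_or_eq.1 hj with hj' | rfl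
          · exact hω.2 i j hi' hj' hij
          · exact hx i hi'
        · rw [(hs _ _).1]
          exact hx j (by omega)
    refine h1.trans ((measureReal_union_le _ _).trans ?_)
    gcongr
    exact measureReal_biUnion_finset_le _ _
  have hsum : ∑ l ∈ Finset.range (m + 1), μ.real (Ev a b (m + 1) ∩ {ω | b ≤ |R1 ω l (m + 1)|})
      = ((m : ℝ) + 1) * μ.real (Ev a b (m + 1) ∩ {ω | b ≤ |R1 ω 0 (m + 1)|}) := by
    rw [Finset.sum_congr rfl (g := fun _ =>
      μ.real (Ev a b (m + 1) ∩ {ω | b ≤ |R1 ω 0 (m + 1)|}))]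
    · simp
    · intro l hl
      simp only [Measure.real]
      rw [swap_invariance μ hsetup hc a b (m + 1) l (Finset.mem_range.1 hl)]
  rw [hsum, hgg] at hsub
  have hcompl : μ.real {ω | b ≤ |R1 ω 0 1|} = 1 - μ.real {ω | |R1 ω 0 1| < b} := by
    rw [← probReal_compl_eq_one_sub
      (measurableSet_lt (measurable_R1 0 1).abs measurable_const)]
    congr 1
    ext ω
    simp
  rw [hcompl] at hsub
  have hp : 0 < μ.real {ω | |R1 ω 0 1| < b} := ENNReal.toReal_pos hb.ne' (measure_ne_top _ _)
  have hE : 0 < μ.real (Ev a b (m + 1)) := ENNReal.toReal_pos h.ne' (measure_ne_top _ _)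
  have : 0 < μ.real (Ev a b (m + 2)) := by nlinarith [mul_pos hE hp]
  exact (ENNReal.toReal_pos_iff.1 this).1

theorem conc_ae (μ : Measure OA) [IsProbabilityMeasure μ]
    (hconc : μ {ω | ∀ l l', |R ω l l'| = |R ω 0 0|} = 1) :
    ∀ᵐ ω ∂μ, ∀ l l', |R ω l l'| = |R ω 0 0| := by
  have hm : MeasurableSet {ω : OA | ∀ l l', |R ω l l'| = |R ω 0 0|} := by
    simp only [Set.setOf_forall]
    exact MeasurableSet.iInter fun l => MeasurableSet.iInter fun l' =>
      measurableSet_eq_fun (measurable_R l l').abs (measurable_R 0 0).abs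
  exact (mem_ae_iff_prob_eq_one hm).2 hconc

theorem null_above (μ : Measure OA) (hsetup : Setup μ)
    (hGG : GG1 μ) (hpsd : PSDas μ)
    (hconc : μ {ω | ∀ l l', |R ω l l'| = |R ω 0 0|} = 1) (a : ℝ)
    (ha : Real.sqrt (sInf (supp1 μ)) < a) : μ {ω | a < |R ω 0 0|} = 0 := by
  have := hsetup.prob
  have hc := conc_ae μ hconc
  by_contra hne
  have ha0 : 0 ≤ a := (Real.sqrt_nonneg _).trans ha.le
  obtain ⟨b, hb1, hb2⟩ := exists_between (Real.lt_sq_of_sqrt_lt ha)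
  obtain ⟨x, hx, hxb⟩ := exists_lt_of_csInf_lt (supp1_nonempty μ) hb1
  have hb : 0 < μ {ω | |R1 ω 0 1| < b} := hx (Set.Iio b) isOpen_Iio hxb
  have hall : ∀ m, 0 < μ (Ev a b (m + 1)) := by
    intro m
    induction m with
    | zero =>
      have : Ev a b (0 + 1) = {ω | a < |R ω 0 0|} := by
        ext ω
        simp only [Ev, Set.mem_inter_iff, Set.mem_setOf_eq, and_iff_left_iff_imp]
        intro _ l l' h1 h2 h3
        omega
      rw [this]
      exact pos_iff_ne_zero.2 hne
    | succ m ih => exact Ev_step μ hsetup hGG hc a b hb m ih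
  obtain ⟨m, hm⟩ := exists_nat_gt ((1 - b) / (a ^ 2 - b))
  have hpos : 0 < a ^ 2 - b := by linarith
  rw [div_lt_iff₀ hpos] at hm
  have hz : μ (Ev a b (m + 1)) = 0 := by
    rw [measure_eq_zero_iff_ae_notMem]
    filter_upwards [hc, hpsd, hsetup.diag] with ω h1 h2 h3 h4
    have := psd_bound ω m a b ha0 (h2 (m + 1) (by omega)) (fun l => (h3 l).1) (h3 0).2 h1 h4
    nlinarith
  exact (hall m).ne' hz

end OverlapArray

/-- In the overlap array setup, suppose `μ` satisfies the
Ghirlanda–Guerra identities for system 1, is a.s. positive semidefinite, and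
`μ(|R_{l,l'}| = |R_{1,1}| for all l,l') = 1`. With `c₁ = inf supp μ₁`, one has
`μ(|R_{1,1}| > √c₁) = 0`. -/
theorem statement_18 (μ : MeasureTheory.Measure OA) (hsetup : Setup μ)
    (hGG : GG1 μ) (hpsd : PSDas μ)
    (hconc : μ {ω | ∀ l l', |R ω l l'| = |R ω 0 0|} = 1) :
    μ {ω | Real.sqrt (sInf (supp1 μ)) < |R ω 0 0|} = 0 := by
  refine measure_mono_null (t := ⋃ k : ℕ,
    {ω | Real.sqrt (sInf (supp1 μ)) + 1 / ((k : ℝ) + 1) < |R ω 0 0|}) ?_ ?_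
  · intro ω hω
    simp only [Set.mem_setOf_eq] at hω
    obtain ⟨k, hk⟩ := exists_nat_one_div_lt (sub_pos.2 hω)
    exact Set.mem_iUnion.2 ⟨k, by simp only [Set.mem_setOf_eq]; linarith⟩
  · refine measure_iUnion_null fun k => null_above μ hsetup hGG hpsd hconc _ ?_
    have : (0 : ℝ) < 1 / ((k : ℝ) + 1) := by positivity
    linarith
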